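/- Let μ_1,…,μ_k be probability measures on ℝ with finite second moments and let w_1,…,w_k ≥ 0 with Σ_j w_j = 1. Let ν be the probability measure on ℝ obtained as the pushforward of the uniform (Lebesgue) measure on (0,1) under the map u ↦ Σ_{j=1}^k w_j F_{μ_j}^{-1}(u), so that the quantile function of ν is the weighted average Σ_j w_j F_{μ_j}^{-1}. Then ν minimizes the barycenter objective B(ν') := Σ_{j=1}^k w_j L(ν', μ_j) over all probability measures ν' on ℝ with finite second moment. -/

import Mathlib

open MeasureTheory ProbabilityTheory

/-- The quantile function `F_μ⁻¹ (u) = inf {x | F_μ x ≥ u}` of a measure on `ℝ`. -/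
noncomputable def quantile (μ : Measure ℝ) (u : ℝ) : ℝ :=
  sInf {x : ℝ | u ≤ cdf μ x}

/-- The Kantorovich cost `L(α,β)` for the quadratic cost on `ℝ`: the infimum of
`∫ |x - y|² dπ` over all couplings `π` of `α` and `β`. -/
noncomputable def kantorovich (α β : Measure ℝ) : ℝ :=
  sInf {c : ℝ | ∃ π : Measure (ℝ × ℝ), IsProbabilityMeasure π ∧
    π.map Prod.fst = α ∧ π.map Prod.snd = β ∧ c = ∫ p, |p.1 - p.2| ^ 2 ∂π}

open Set Filter Topology

/-- The quantile function and the cdf form a Galois connection over the levels in `(0, 1)`. -/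
lemma quantile_le_iff (μ : Measure ℝ) {u : ℝ} (hu : u ∈ Ioo (0 : ℝ) 1) (x : ℝ) :
    quantile μ u ≤ x ↔ u ≤ cdf μ x := by
  have hne : {x : ℝ | u ≤ cdf μ x}.Nonempty :=
    ((tendsto_cdf_atTop μ).eventually (eventually_ge_nhds hu.2)).exists
  have hbdd : BddBelow {x : ℝ | u ≤ cdf μ x} := by
    obtain ⟨a, ha⟩ := ((tendsto_cdf_atBot μ).eventually (eventually_lt_nhds hu.1)).exists
    refine ⟨a, fun y hy => ?_⟩
    by_contra! h
    exact absurd (hy.trans (monotone_cdf μ h.le)) (not_le.2 ha)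
  refine ⟨fun h => ?_, fun h => csInf_le hbdd h⟩
  have hright : Tendsto (cdf μ) (𝓝[>] x) (𝓝 (cdf μ x)) :=
    ((cdf μ).right_continuous x).mono_left (nhdsWithin_mono _ Ioi_subset_Ici_self)
  refine ge_of_tendsto hright ?_
  filter_upwards [self_mem_nhdsWithin] with y hy
  obtain ⟨z, hz, hzy⟩ := exists_lt_of_csInf_lt hne (lt_of_le_of_lt h hy)
  exact hz.trans (monotone_cdf μ hzy.le)

lemma monotoneOn_quantile (μ : Measure ℝ) : MonotoneOn (quantile μ) (Ioo 0 1) := by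
  intro u hu v hv huv
  rw [quantile_le_iff μ hu]
  exact huv.trans ((quantile_le_iff μ hv _).1 le_rfl)

lemma aemeasurable_quantile (μ : Measure ℝ) :
    AEMeasurable (quantile μ) (volume.restrict (Ioo (0 : ℝ) 1)) :=
  aemeasurable_restrict_of_monotoneOn measurableSet_Ioo (monotoneOn_quantile μ)

instance isProbabilityMeasure_restrict_Ioo_zero_one :
    IsProbabilityMeasure (volume.restrict (Ioo (0 : ℝ) 1)) :=
  ⟨by simp⟩

/-- The quantile function pushes the uniform measure on `(0, 1)` forward to the measure. -/
lemma map_quantile (μ : Measure ℝ) [IsProbabilityMeasure μ] :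
    (volume.restrict (Ioo (0 : ℝ) 1)).map (quantile μ) = μ := by
  have : IsProbabilityMeasure ((volume.restrict (Ioo (0 : ℝ) 1)).map (quantile μ)) :=
    Measure.isProbabilityMeasure_map (aemeasurable_quantile μ)
  refine Measure.ext_of_Iic _ _ fun a => ?_
  rw [Measure.map_apply_of_aemeasurable (aemeasurable_quantile μ) measurableSet_Iic,
    Measure.restrict_apply' measurableSet_Ioo, ← ofReal_cdf μ a]
  have hset : quantile μ ⁻¹' Iic a ∩ Ioo 0 1 = Iic (cdf μ a) ∩ Ioo 0 1 := by
    ext u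
    simp only [mem_inter_iff, mem_preimage, mem_Iic, and_congr_left_iff]
    exact fun hu => quantile_le_iff μ hu a
  rw [hset]
  refine le_antisymm ?_ ?_
  · calc volume (Iic (cdf μ a) ∩ Ioo 0 1) ≤ volume (Ioc 0 (cdf μ a)) :=
          measure_mono fun u hu => ⟨hu.2.1, hu.1⟩
      _ = ENNReal.ofReal (cdf μ a) := by simp
  · calc ENNReal.ofReal (cdf μ a) = volume (Ioo 0 (cdf μ a)) := by simp
      _ ≤ volume (Iic (cdf μ a) ∩ Ioo 0 1) :=
          measure_mono fun u hu => ⟨hu.2.le, hu.1, hu.2.trans_le (cdf_le_one μ a)⟩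

lemma memLp_two_id_of_integrable_abs_sq {μ : Measure ℝ} (h : Integrable (fun x => |x| ^ 2) μ) :
    MemLp id 2 μ := by
  rw [memLp_two_iff_integrable_sq aestronglyMeasurable_id]
  simpa using h

lemma memLp_quantile {μ : Measure ℝ} [IsProbabilityMeasure μ]
    (h : Integrable (fun x => |x| ^ 2) μ) :
    MemLp (quantile μ) 2 (volume.restrict (Ioo (0 : ℝ) 1)) := by
  have hid : MemLp id 2 ((volume.restrict (Ioo (0 : ℝ) 1)).map (quantile μ)) := by
    rw [map_quantile]
    exact memLp_two_id_of_integrable_abs_sq h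
  exact hid.comp_of_map (aemeasurable_quantile μ)

/-- The squared distance as the area of the square with the two points as opposite corners. -/
lemma ofReal_abs_sub_sq_eq_volume (x y : ℝ) :
    ENNReal.ofReal (|x - y| ^ 2) =
      volume (Ico x y ×ˢ Ico x y) + volume (Ico y x ×ˢ Ico y x) := by
  rw [Measure.volume_eq_prod, Measure.prod_prod, Measure.prod_prod, Real.volume_Ico,
    Real.volume_Ico]
  rcases le_total x y with h | h
  · rw [ENNReal.ofReal_of_nonpos (sub_nonpos.2 h), ← ENNReal.ofReal_mul (sub_nonneg.2 h), sq_abs]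
    simp only [mul_zero, add_zero]
    congr 1
    ring
  · rw [ENNReal.ofReal_of_nonpos (sub_nonpos.2 h), ← ENNReal.ofReal_mul (sub_nonneg.2 h), sq_abs]
    simp only [mul_zero, zero_add]
    congr 1
    ring

lemma measurableSet_square_incidence :
    MeasurableSet {q : (ℝ × ℝ) × (ℝ × ℝ) | q.2 ∈ Ico q.1.1 q.1.2 ×ˢ Ico q.1.1 q.1.2} := by
  simp only [mem_prod, mem_Ico]
  measurability

/-- The Tonelli theorem for the incidence of points of the plane with squares on the diagonal. -/
lemma lintegral_volume_square (π : Measure (ℝ × ℝ)) [SFinite π] :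
    ∫⁻ p, volume (Ico p.1 p.2 ×ˢ Ico p.1 p.2) ∂π =
      ∫⁻ z : ℝ × ℝ, π {p | p.1 ≤ min z.1 z.2 ∧ max z.1 z.2 < p.2} := by
  have hleft := Measure.prod_apply (μ := π) (ν := (volume : Measure (ℝ × ℝ)))
    measurableSet_square_incidence
  have hright := Measure.prod_apply_symm (μ := π) (ν := (volume : Measure (ℝ × ℝ)))
    measurableSet_square_incidence
  refine hleft.symm.trans (hright.trans (lintegral_congr fun z => congrArg π ?_))
  ext p
  simp only [mem_preimage, mem_ofPred_eq, mem_prod, mem_Ico, le_min_iff, max_lt_iff]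
  tauto

lemma measurable_volume_square :
    Measurable fun p : ℝ × ℝ => volume (Ico p.1 p.2 ×ˢ Ico p.1 p.2) :=
  measurable_measure_prodMk_left measurableSet_square_incidence

lemma measurableSet_le_const_and_const_lt {Ω : Type*} [MeasurableSpace Ω] {X Y : Ω → ℝ}
    (hX : Measurable X) (hY : Measurable Y) (a b : ℝ) :
    MeasurableSet {p | X p ≤ a ∧ b < Y p} :=
  (measurableSet_le hX measurable_const).inter (measurableSet_lt measurable_const hY)

/-- The quadratic transport cost of a plan in terms of the masses of quadrants. -/
lemma lintegral_abs_sub_sq_eq (π : Measure (ℝ × ℝ)) [SFinite π] :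
    ∫⁻ p, ENNReal.ofReal (|p.1 - p.2| ^ 2) ∂π =
      (∫⁻ z : ℝ × ℝ, π {p | p.1 ≤ min z.1 z.2 ∧ max z.1 z.2 < p.2}) +
      ∫⁻ z : ℝ × ℝ, π {p | p.2 ≤ min z.1 z.2 ∧ max z.1 z.2 < p.1} := by
  simp_rw [ofReal_abs_sub_sq_eq_volume]
  rw [lintegral_add_left measurable_volume_square, lintegral_volume_square]
  congr 1
  have hswap := lintegral_volume_square (π.map Prod.swap)
  rw [lintegral_map measurable_volume_square measurable_swap] at hswap
  refine hswap.trans (lintegral_congr fun z => ?_)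
  rw [Measure.map_apply measurable_swap
    (measurableSet_le_const_and_const_lt measurable_fst measurable_snd _ _)]
  rfl

/-- The mass that a coupling gives to a quadrant is at least the excess of the cdfs. -/
lemma measure_Iic_sub_le {Ω : Type*} [MeasurableSpace Ω] (m : Measure Ω) {X Y : Ω → ℝ}
    (hX : Measurable X) (hY : Measurable Y) (a b : ℝ) :
    m.map X (Iic a) - m.map Y (Iic b) ≤ m {p | X p ≤ a ∧ b < Y p} := by
  rw [Measure.map_apply hX measurableSet_Iic, Measure.map_apply hY measurableSet_Iic,
    tsub_le_iff_right]
  refine (measure_mono fun p hp => ?_).trans (measure_union_le _ _)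
  by_cases h : b < Y p
  · exact Or.inl ⟨hp, h⟩
  · exact Or.inr (not_lt.1 h)

/-- The quantile coupling attains the minimal mass of each quadrant. -/
lemma volume_quantile_le_lt (α β : Measure ℝ) [IsProbabilityMeasure α] [IsProbabilityMeasure β]
    (a b : ℝ) :
    volume.restrict (Ioo (0 : ℝ) 1) {u | quantile α u ≤ a ∧ b < quantile β u} ≤
      α (Iic a) - β (Iic b) := by
  rw [Measure.restrict_apply' measurableSet_Ioo, ← ofReal_cdf α, ← ofReal_cdf β,
    ← ENNReal.ofReal_sub _ (cdf_nonneg β b), ← Real.volume_Ioc]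
  refine measure_mono fun u hu => ⟨?_, (quantile_le_iff α hu.2 a).1 hu.1.1⟩
  rw [← not_le, ← quantile_le_iff β hu.2, not_le]
  exact hu.1.2

/-- The quantile coupling has the least quadratic cost among all couplings. -/
lemma lintegral_quantile_sub_sq_le (π : Measure (ℝ × ℝ)) (α β : Measure ℝ) [SFinite π]
    [IsProbabilityMeasure α] [IsProbabilityMeasure β]
    (hα : π.map Prod.fst = α) (hβ : π.map Prod.snd = β) :
    ∫⁻ u in Ioo (0 : ℝ) 1, ENNReal.ofReal (|quantile α u - quantile β u| ^ 2) ≤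
      ∫⁻ p, ENNReal.ofReal (|p.1 - p.2| ^ 2) ∂π := by
  have hae : AEMeasurable (fun u => (quantile α u, quantile β u))
      (volume.restrict (Ioo (0 : ℝ) 1)) :=
    (aemeasurable_quantile α).prodMk (aemeasurable_quantile β)
  have hcost : Measurable fun p : ℝ × ℝ => ENNReal.ofReal (|p.1 - p.2| ^ 2) := by fun_prop
  rw [← lintegral_map' (f := fun p : ℝ × ℝ => ENNReal.ofReal (|p.1 - p.2| ^ 2))
    hcost.aemeasurable hae, lintegral_abs_sub_sq_eq, lintegral_abs_sub_sq_eq]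
  refine add_le_add (lintegral_mono fun z => ?_) (lintegral_mono fun z => ?_)
  · rw [Measure.map_apply_of_aemeasurable hae
      (measurableSet_le_const_and_const_lt measurable_fst measurable_snd _ _)]
    refine (volume_quantile_le_lt α β _ _).trans ?_
    rw [← hα, ← hβ]
    exact measure_Iic_sub_le π measurable_fst measurable_snd _ _
  · rw [Measure.map_apply_of_aemeasurable hae
      (measurableSet_le_const_and_const_lt measurable_snd measurable_fst _ _)]
    refine (volume_quantile_le_lt β α _ _).trans ?_
    rw [← hα, ← hβ]
    exact measure_Iic_sub_le π measurable_snd measurable_fst _ _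

/-- Any pair of random variables bounds the Kantorovich cost of their laws from above. -/
lemma kantorovich_map_le {Ω : Type*} [MeasurableSpace Ω] (m : Measure Ω) [IsProbabilityMeasure m]
    {X Y : Ω → ℝ} (hX : AEMeasurable X m) (hY : AEMeasurable Y m) :
    kantorovich (m.map X) (m.map Y) ≤ ∫ ω, |X ω - Y ω| ^ 2 ∂m := by
  have hXY : AEMeasurable (fun ω => (X ω, Y ω)) m := hX.prodMk hY
  refine csInf_le ⟨0, ?_⟩ ⟨m.map fun ω => (X ω, Y ω), Measure.isProbabilityMeasure_map hXY,
    ?_, ?_, ?_⟩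
  · rintro c ⟨π, -, -, -, rfl⟩
    positivity
  · rw [AEMeasurable.map_map_of_aemeasurable measurable_fst.aemeasurable hXY]
    rfl
  · rw [AEMeasurable.map_map_of_aemeasurable measurable_snd.aemeasurable hXY]
    rfl
  · rw [integral_map hXY]
    exact Measurable.aestronglyMeasurable (by fun_prop)

/-- The cost of the quantile coupling bounds the Kantorovich cost from below. -/
lemma integral_quantile_sub_sq_le_kantorovich (α β : Measure ℝ) [IsProbabilityMeasure α]
    [IsProbabilityMeasure β] (hα : Integrable (fun x => |x| ^ 2) α)
    (hβ : Integrable (fun x => |x| ^ 2) β) :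
    ∫ u in Ioo (0 : ℝ) 1, |quantile α u - quantile β u| ^ 2 ≤ kantorovich α β := by
  refine le_csInf ⟨_, α.prod β, inferInstance, by simp, by simp, rfl⟩ ?_
  rintro c ⟨π, hπ, hπα, hπβ, rfl⟩
  have hfst : MemLp Prod.fst 2 π :=
    MemLp.comp_of_map (g := id) (by rw [hπα]; exact memLp_two_id_of_integrable_abs_sq hα)
      measurable_fst.aemeasurable
  have hsnd : MemLp Prod.snd 2 π :=
    MemLp.comp_of_map (g := id) (by rw [hπβ]; exact memLp_two_id_of_integrable_abs_sq hβ)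
      measurable_snd.aemeasurable
  have hcost_int : Integrable (fun p : ℝ × ℝ => |p.1 - p.2| ^ 2) π := by
    simpa using (hfst.sub hsnd).integrable_sq
  have hq : Integrable (fun u => |quantile α u - quantile β u| ^ 2)
      (volume.restrict (Ioo (0 : ℝ) 1)) := by
    simpa using ((memLp_quantile hα).sub (memLp_quantile hβ)).integrable_sq
  rw [integral_eq_lintegral_of_nonneg_ae (ae_of_all _ fun _ => by positivity)
      hq.aestronglyMeasurable,
    integral_eq_lintegral_of_nonneg_ae (ae_of_all _ fun _ => by positivity)
      hcost_int.aestronglyMeasurable]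
  refine ENNReal.toReal_mono ?_ (lintegral_quantile_sub_sq_le π α β hπα hπβ)
  rw [← ofReal_integral_eq_lintegral_ofReal hcost_int (ae_of_all _ fun _ => by positivity)]
  exact ENNReal.ofReal_ne_top

/-- The weighted mean minimizes the weighted sum of squared distances. -/
lemma sum_mul_abs_mean_sub_sq_le {ι : Type*} [Fintype ι] (w q : ι → ℝ) (hw1 : ∑ j, w j = 1)
    (a : ℝ) :
    ∑ j, w j * |∑ i, w i * q i - q j| ^ 2 ≤ ∑ j, w j * |a - q j| ^ 2 := by
  set m := ∑ i, w i * q i with hm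
  have hexpand (c : ℝ) :
      ∑ j, w j * |c - q j| ^ 2 = c ^ 2 - 2 * c * m + ∑ j, w j * q j ^ 2 := by
    calc ∑ j, w j * |c - q j| ^ 2
        = ∑ j, (c ^ 2 * w j - 2 * c * (w j * q j) + w j * q j ^ 2) :=
          Finset.sum_congr rfl fun j _ => by rw [sq_abs]; ring
      _ = c ^ 2 - 2 * c * m + ∑ j, w j * q j ^ 2 := by
          rw [Finset.sum_add_distrib, Finset.sum_sub_distrib, ← Finset.mul_sum, ← Finset.mul_sum,
            hw1, mul_one]
  rw [hexpand, hexpand]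
  nlinarith [sq_nonneg (a - m)]

/-- The univariate barycenter: the pushforward `ν` of the uniform measure
on `(0,1)` under the weighted average of quantile functions `u ↦ ∑ j, w j * F_{μ j}⁻¹ u`
minimizes the barycenter objective `ν' ↦ ∑ j, w j * L(ν', μ j)` over all probability
measures on `ℝ` with finite second moment. -/
theorem univariate_barycenter
    (k : ℕ) (μ : Fin k → Measure ℝ) (hμ : ∀ j, IsProbabilityMeasure (μ j))
    (hμ2 : ∀ j, Integrable (fun x => |x| ^ 2) (μ j))
    (w : Fin k → ℝ) (hw : ∀ j, 0 ≤ w j) (hw1 : ∑ j, w j = 1)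
    (ν : Measure ℝ)
    (hν : ν = Measure.map (fun u => ∑ j, w j * quantile (μ j) u)
      (volume.restrict (Set.Ioo (0 : ℝ) 1))) :
    ∀ ν' : Measure ℝ, IsProbabilityMeasure ν' → Integrable (fun x => |x| ^ 2) ν' →
      ∑ j, w j * kantorovich ν (μ j) ≤ ∑ j, w j * kantorovich ν' (μ j) := by
  intro ν' hν'p hν'
  have hmean : MemLp (fun u => ∑ j, w j * quantile (μ j) u) 2
      (volume.restrict (Ioo (0 : ℝ) 1)) :=
    memLp_finsetSum _ fun j _ => (memLp_quantile (hμ2 j)).const_mul (w j)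
  have hcost_int {f : ℝ → ℝ} (hf : MemLp f 2 (volume.restrict (Ioo (0 : ℝ) 1))) (j : Fin k) :
      Integrable (fun u => w j * |f u - quantile (μ j) u| ^ 2)
        (volume.restrict (Ioo (0 : ℝ) 1)) := by
    simpa using ((hf.sub (memLp_quantile (hμ2 j))).integrable_sq).const_mul (w j)
  have hupper (j : Fin k) : kantorovich ν (μ j) ≤
      ∫ u in Ioo (0 : ℝ) 1, |∑ i, w i * quantile (μ i) u - quantile (μ j) u| ^ 2 := by
    have h := kantorovich_map_le (volume.restrict (Ioo (0 : ℝ) 1))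
      hmean.aestronglyMeasurable.aemeasurable (aemeasurable_quantile (μ j))
    rwa [map_quantile, ← hν] at h
  calc ∑ j, w j * kantorovich ν (μ j)
      ≤ ∑ j, w j * ∫ u in Ioo (0 : ℝ) 1,
          |∑ i, w i * quantile (μ i) u - quantile (μ j) u| ^ 2 :=
        Finset.sum_le_sum fun j _ => mul_le_mul_of_nonneg_left (hupper j) (hw j)
    _ = ∫ u in Ioo (0 : ℝ) 1,
          ∑ j, w j * |∑ i, w i * quantile (μ i) u - quantile (μ j) u| ^ 2 := by
        rw [integral_finsetSum _ fun j _ => hcost_int hmean j]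
        simp_rw [integral_const_mul]
    _ ≤ ∫ u in Ioo (0 : ℝ) 1, ∑ j, w j * |quantile ν' u - quantile (μ j) u| ^ 2 :=
        integral_mono (integrable_finsetSum _ fun j _ => hcost_int hmean j)
          (integrable_finsetSum _ fun j _ => hcost_int (memLp_quantile hν') j)
          fun u => sum_mul_abs_mean_sub_sq_le w (fun j => quantile (μ j) u) hw1 _
    _ = ∑ j, w j * ∫ u in Ioo (0 : ℝ) 1, |quantile ν' u - quantile (μ j) u| ^ 2 := by
        rw [integral_finsetSum _ fun j _ => hcost_int (memLp_quantile hν') j]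
        simp_rw [integral_const_mul]
    _ ≤ ∑ j, w j * kantorovich ν' (μ j) :=
        Finset.sum_le_sum fun j _ => mul_le_mul_of_nonneg_left
          (integral_quantile_sub_sq_le_kantorovich ν' (μ j) hν' (hμ2 j)) (hw j)
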